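/- Let λ ≥ 0 and suppose ‖Z‖_{𝓘^d} ≤ λ. Let S_1 = [s_1,e_1], …, S_R = [s_R,e_R] be intervals contained in [1,T] such that D_{S_i} > λ for every i, and such that the sets S_i^- = [s_i, e_i − 1], i = 1,…,R, are mutually disjoint. Then the number N of change-points satisfies N ≥ R. -/

import Mathlib

open Finset MeasureTheory

/-- Scaled partial sum `U_{s,e}(y) = (e-s+1)^{-1/2} ∑_{t=s}^e y_t`. -/
noncomputable def scaledPartialSum (y : ℕ → ℝ) (s e : ℕ) : ℝ :=
  (∑ t ∈ Finset.Icc s e, y t) / Real.sqrt ((e : ℝ) - (s : ℝ) + 1)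

/-- Multiresolution sup-norm of `y` over the collection `I` of intervals (given
as pairs of endpoints). -/
noncomputable def mrNorm (y : ℕ → ℝ) (I : Set (ℕ × ℕ)) : ℝ :=
  sSup ((fun q : ℕ × ℕ => |scaledPartialSum y q.1 q.2|) '' I)

/-- The collection `𝓘^a` of all intervals `[s,e] ⊆ [1,T]`. -/
def allIntervals (T : ℕ) : Set (ℕ × ℕ) :=
  {q | 1 ≤ q.1 ∧ q.1 ≤ q.2 ∧ q.2 ≤ T}

/-- The collection `𝓘^d` of all intervals `[s,e] ⊆ [1,T]` of dyadic lengths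
`e - s = 2^j - 1`, `j = 0, …, ⌊log₂ T⌋`. -/
def dyadicIntervals (T : ℕ) : Set (ℕ × ℕ) :=
  {q | 1 ≤ q.1 ∧ q.1 ≤ q.2 ∧ q.2 ≤ T ∧
    ∃ j : ℕ, j ≤ Nat.log 2 T ∧ q.2 - q.1 = 2 ^ j - 1}

/-- Restriction `𝓘_{[s,e]}` of a collection of intervals to those contained in `[s,e]`. -/
def restrictTo (I : Set (ℕ × ℕ)) (s e : ℕ) : Set (ℕ × ℕ) :=
  {q ∈ I | s ≤ q.1 ∧ q.2 ≤ e}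

/-- `D_{[s,e]} = inf_β ‖Y_{s:e} − X_{s:e,·}β‖_{𝓘^d_{[s,e]}}`. -/
noncomputable def Ddev {p : ℕ} (T : ℕ) (X : ℕ → Fin p → ℝ) (Y : ℕ → ℝ) (s e : ℕ) : ℝ :=
  sInf (Set.range fun β : Fin p → ℝ =>
    mrNorm (fun t => Y t - ∑ i, X t i * β i) (restrictTo (dyadicIntervals T) s e))

theorem mrNorm_nonneg (y : ℕ → ℝ) (I : Set (ℕ × ℕ)) : 0 ≤ mrNorm y I := by
  refine Real.sSup_nonneg ?_
  rintro _ ⟨q, -, rfl⟩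
  exact abs_nonneg _

theorem finite_dyadicIntervals (T : ℕ) : (dyadicIntervals T).Finite := by
  refine (Set.finite_Iic (T, T)).subset ?_
  rintro ⟨a, b⟩ ⟨-, hab, hb, -⟩
  exact ⟨le_trans hab hb, hb⟩

theorem abs_scaledPartialSum_le_mrNorm (y : ℕ → ℝ) {I : Set (ℕ × ℕ)} (hI : I.Finite)
    {q : ℕ × ℕ} (hq : q ∈ I) : |scaledPartialSum y q.1 q.2| ≤ mrNorm y I :=
  le_csSup (hI.image _).bddAbove (Set.mem_image_of_mem _ hq)

/-- If one linear model with noise `Z` holds on all of `[s,e]`, the deviation there is at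
most any nonnegative bound on the multiresolution norm of `Z`. -/
theorem Ddev_le_of_model {p : ℕ} (T : ℕ) (X : ℕ → Fin p → ℝ) (Y Z : ℕ → ℝ) (b : Fin p → ℝ)
    {lam : ℝ} (hlam : 0 ≤ lam) (hZ : mrNorm Z (dyadicIntervals T) ≤ lam) {s e : ℕ}
    (h : ∀ t, s ≤ t → t ≤ e → Y t = (∑ i, X t i * b i) + Z t) :
    Ddev T X Y s e ≤ lam := by
  have hbdd : BddBelow (Set.range fun β : Fin p → ℝ =>
      mrNorm (fun t => Y t - ∑ i, X t i * β i) (restrictTo (dyadicIntervals T) s e)) := by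
    refine ⟨0, ?_⟩
    rintro _ ⟨β, rfl⟩
    exact mrNorm_nonneg _ _
  refine (csInf_le hbdd ⟨b, rfl⟩).trans (Real.sSup_le ?_ hlam)
  rintro _ ⟨q, ⟨hq, hs, he⟩, rfl⟩
  refine le_trans (le_of_eq ?_)
    ((abs_scaledPartialSum_le_mrNorm Z (finite_dyadicIntervals T) hq).trans hZ)
  simp only [scaledPartialSum]
  congr 2
  refine Finset.sum_congr rfl fun t ht => ?_
  rw [Finset.mem_Icc] at ht
  rw [h t (hs.trans ht.1) (ht.2.trans he)]
  ring

/-- if `‖Z‖_{𝓘^d} ≤ λ` and `S_1, …, S_R ⊆ [1,T]` satisfy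
`D_{S_i} > λ` with the sets `S_i^- = [s_i, e_i − 1]` mutually disjoint, then the
number `N` of change-points satisfies `N ≥ R`. -/
theorem stmt_3 (T p N : ℕ) (X : ℕ → Fin p → ℝ) (Y Z : ℕ → ℝ)
    (η : ℕ → ℕ) (β : ℕ → Fin p → ℝ)
    (hη0 : η 0 = 0) (hηlast : η (N + 1) = T)
    (hmono : ∀ j ≤ N, η j < η (j + 1))
    (hmodel : ∀ j ≤ N, ∀ t, η j < t → t ≤ η (j + 1) →
      Y t = (∑ i, X t i * β j i) + Z t)
    (lam : ℝ) (hlam : 0 ≤ lam) (hZ : mrNorm Z (dyadicIntervals T) ≤ lam)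
    (R : ℕ) (S : ℕ → ℕ × ℕ)
    (hS : ∀ i, 1 ≤ i → i ≤ R → 1 ≤ (S i).1 ∧ (S i).1 ≤ (S i).2 ∧ (S i).2 ≤ T)
    (hD : ∀ i, 1 ≤ i → i ≤ R → Ddev T X Y (S i).1 (S i).2 > lam)
    (hdisj : ∀ i i', 1 ≤ i → i ≤ R → 1 ≤ i' → i' ≤ R → i ≠ i' →
      Disjoint (Finset.Icc (S i).1 ((S i).2 - 1)) (Finset.Icc (S i').1 ((S i').2 - 1))) :
    N ≥ R := by
  have hchange : ∀ i ∈ Finset.Icc 1 R, ∃ j ∈ Finset.Icc 1 N,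
      η j ∈ Finset.Icc (S i).1 ((S i).2 - 1) := by
    intro i hi
    rw [Finset.mem_Icc] at hi
    obtain ⟨hs, hse, he⟩ := hS i hi.1 hi.2
    have hex : ∃ m, (S i).1 ≤ η m := ⟨N + 1, by omega⟩
    obtain ⟨m, hm, hmin⟩ : ∃ m, (S i).1 ≤ η m ∧ ∀ k < m, ¬ (S i).1 ≤ η k :=
      ⟨Nat.find hex, Nat.find_spec hex, fun _ => Nat.find_min hex⟩
    obtain _ | k := m
    · omega
    have hkN : k ≤ N := by
      by_contra hk
      exact hmin (N + 1) (by omega) (by omega)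
    have hk : η k < (S i).1 := not_le.mp (hmin k k.lt_succ_self)
    have hlt : η (k + 1) < (S i).2 := by
      by_contra hle
      refine absurd (Ddev_le_of_model T X Y Z (β k) hlam hZ fun t ht ht' => ?_)
        (not_le.mpr (hD i hi.1 hi.2))
      exact hmodel k hkN t (by omega) (by omega)
    have hne : k ≠ N := by
      rintro rfl
      omega
    exact ⟨k + 1, Finset.mem_Icc.mpr (by omega), Finset.mem_Icc.mpr (by omega)⟩
  choose! f hf hfS using hchange
  have hinj : Set.InjOn f (Finset.Icc 1 R : Finset ℕ) := by
    intro i hi i' hi' heq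
    rw [Finset.mem_coe] at hi hi'
    by_contra hne
    have h := hfS i hi
    have h' := hfS i' hi'
    rw [← heq] at h'
    rw [Finset.mem_Icc] at hi hi'
    exact Finset.disjoint_left.mp (hdisj i i' hi.1 hi.2 hi'.1 hi'.2 hne) h h'
  simpa using Finset.card_le_card_of_injOn f hf hinj
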